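/- (Theorem 1.5, part 3) Let m ∈ ℝ, γ > 0 and W ∈ C⁴(ℝ) with W''''(t) = w² for all t ∈ ℝ, for some constant w > 0. Assume N < 6 and the strict inequality W''(m) + min_{k ∈ 2πℤ^N, k ≠ 0} ( |k|²/γ² + 1/|k|² ) > 0. If Q_N < (W'''(m))² / (3w²), then m is not a global minimizer of ℰ over H¹_m(𝕋^N): there exists φ ∈ H¹_m(𝕋^N) with ℰ(φ) < ℰ(m). -/

import Mathlib

open MeasureTheory Filter Real

noncomputable section

abbrev Pt (N : ℕ) := Fin N → ℝ

/-- partial derivative in direction `i` -/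
def pd {N : ℕ} (i : Fin N) (f : Pt N → ℝ) (x : Pt N) : ℝ := fderiv ℝ f x (Pi.single i 1)

/-- second partial derivative ∂ᵢ∂ⱼ -/
def pd2 {N : ℕ} (i j : Fin N) (f : Pt N → ℝ) : Pt N → ℝ := pd i (pd j f)

/-- the unit cube [0,1]^N, fundamental domain of the torus 𝕋^N -/
def cube (N : ℕ) : Set (Pt N) := Set.Icc 0 1

/-- Laplacian on the torus -/
def lap {N : ℕ} (f : Pt N → ℝ) (x : Pt N) : ℝ := ∑ i, pd2 i i f x

/-- |∇f|² -/
def gradSq {N : ℕ} (f : Pt N → ℝ) (x : Pt N) : ℝ := ∑ i, (pd i f x)^2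

/-- 1-periodicity in each coordinate: a function on the torus 𝕋^N -/
def ZPeriodic {N : ℕ} (f : Pt N → ℝ) : Prop :=
  ∀ (x : Pt N) (i : Fin N), f (x + Pi.single i 1) = f x

/-- min_{k ∈ 2πℤ^N, k ≠ 0} (α - |k|²)² -/
def freqMinPFC (N : ℕ) (α : ℝ) : ℝ :=
  sInf {t : ℝ | ∃ k : Fin N → ℤ, k ≠ 0 ∧ t = (α - 4*π^2 * ∑ i, ((k i : ℝ))^2)^2}

/-- admissible test functions in the definition of P_N -/
def AdmissibleP {N : ℕ} (u : Pt N → ℝ) : Prop :=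
  ContDiff ℝ 2 u ∧ ZPeriodic u ∧
    (∫ x in cube N, (u x)^3) = 1 ∧ (∫ x in cube N, u x) = 0

/-- the product (∫ (αu+Δu)² + c u²) · (∫ u⁴) -/
def Penergy {N : ℕ} (α c : ℝ) (u : Pt N → ℝ) : ℝ :=
  (∫ x in cube N, ((α * u x + lap u x)^2 + c * (u x)^2)) * (∫ x in cube N, (u x)^4)

/-- the optimal constant P_N (with c = W''(m)) -/
def PN (N : ℕ) (α c : ℝ) : ℝ :=
  sInf {p : ℝ | ∃ u : Pt N → ℝ, AdmissibleP u ∧ p = Penergy α c u}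

/-- membership in H²_m(𝕋^N) -/
def MemH2m {N : ℕ} (m : ℝ) (φ : Pt N → ℝ) : Prop :=
  ContDiff ℝ 2 φ ∧ ZPeriodic φ ∧ (∫ x in cube N, φ x) = m

/-- the PFC functional 𝓕 on the torus -/
def Fen {N : ℕ} (α : ℝ) (W : ℝ → ℝ) (φ : Pt N → ℝ) : ℝ :=
  ∫ x in cube N, ((1/2) * (α * φ x + lap φ x)^2 + W (φ x))

/-- ψ = (-Δ)⁻¹ u : the unique zero-average (periodic) solution of -Δψ = u -/
def IsPotential {N : ℕ} (u ψ : Pt N → ℝ) : Prop :=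
  ContDiff ℝ 2 ψ ∧ ZPeriodic ψ ∧ (∫ x in cube N, ψ x) = 0 ∧ ∀ x : Pt N, -lap ψ x = u x

/-- min_{k ∈ 2πℤ^N, k ≠ 0} (|k|²/γ² + 1/|k|²) -/
def freqMinOK (N : ℕ) (γ : ℝ) : ℝ :=
  sInf {t : ℝ | ∃ k : Fin N → ℤ, k ≠ 0 ∧
    t = (4*π^2 * ∑ i, ((k i : ℝ))^2) / γ^2 + 1 / (4*π^2 * ∑ i, ((k i : ℝ))^2)}

/-- admissible test functions in the definition of Q_N -/
def AdmissibleQ {N : ℕ} (u : Pt N → ℝ) : Prop :=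
  ContDiff ℝ 1 u ∧ ZPeriodic u ∧
    (∫ x in cube N, (u x)^3) = 1 ∧ (∫ x in cube N, u x) = 0

/-- the product (∫ γ⁻²|∇u|² + |∇(-Δ)⁻¹u|² + c u²) · (∫ u⁴), where ψ = (-Δ)⁻¹u -/
def Qenergy {N : ℕ} (γ c : ℝ) (u ψ : Pt N → ℝ) : ℝ :=
  (∫ x in cube N, ((1/γ^2) * gradSq u x + gradSq ψ x + c * (u x)^2)) *
    (∫ x in cube N, (u x)^4)

/-- the optimal constant Q_N (with c = W''(m)) -/
def QN (N : ℕ) (γ c : ℝ) : ℝ :=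
  sInf {q : ℝ | ∃ u ψ : Pt N → ℝ, AdmissibleQ u ∧ IsPotential u ψ ∧ q = Qenergy γ c u ψ}

/-- membership in H¹_m(𝕋^N) -/
def MemH1m {N : ℕ} (m : ℝ) (φ : Pt N → ℝ) : Prop :=
  ContDiff ℝ 1 φ ∧ ZPeriodic φ ∧ (∫ x in cube N, φ x) = m

/-- the Ohta–Kawasaki energy, expressed through ψ = (-Δ)⁻¹(φ - m) -/
def Een {N : ℕ} (γ : ℝ) (W : ℝ → ℝ) (φ ψ : Pt N → ℝ) : ℝ :=
  ∫ x in cube N, ((1/(2*γ^2)) * gradSq φ x + (1/2) * gradSq ψ x + W (φ x))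

section Helpers

lemma aux_eq_of_deriv (F P p : ℝ → ℝ) (m : ℝ) (hF : Differentiable ℝ F)
    (hP : ∀ x, HasDerivAt P (p x) x) (hd : ∀ x, deriv F x = p x) (h0 : F m = P m) :
    ∀ x, F x = P x := by
  intro x
  have hder : ∀ y, HasDerivAt (fun y => F y - P y) 0 y := by
    intro y
    have := (hF y).hasDerivAt.sub (hP y)
    rw [hd y, sub_self] at this
    exact this
  have := is_const_of_deriv_eq_zero (fun y => (hder y).differentiableAt)
    (fun y => (hder y).deriv) x m
  linarith

lemma aux_taylor (W : ℝ → ℝ) (m k : ℝ) (hW : ContDiff ℝ 4 W)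
    (h4 : ∀ t, iteratedDeriv 4 W t = k) (x : ℝ) :
    W x = W m + iteratedDeriv 1 W m * (x - m) + iteratedDeriv 2 W m / 2 * (x - m)^2
      + iteratedDeriv 3 W m / 6 * (x-m)^3 + k / 24 * (x-m)^4 := by
  have d : ∀ n : ℕ, n < 4 → Differentiable ℝ (iteratedDeriv n W) := fun n hn =>
    hW.differentiable_iteratedDeriv n (by exact_mod_cast hn)
  have hp : ∀ (n : ℕ) (y : ℝ), HasDerivAt (fun y => (y - m)^(n+1)) ((n+1 : ℝ) * (y-m)^n) y := by
    intro n y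
    have := ((hasDerivAt_id y).sub_const m).pow (n+1)
    refine this.congr_deriv ?_
    simp
  have e3 : ∀ x, iteratedDeriv 3 W x = iteratedDeriv 3 W m + k * (x-m)^1 := by
    refine aux_eq_of_deriv _ _ (fun _ => k) m (d 3 (by norm_num)) ?_ ?_ (by simp)
    · intro y
      exact (((hp 0 y).const_mul k).const_add _).congr_deriv (by norm_num)
    · intro y; rw [← h4 y, ← iteratedDeriv_succ]
  have e2 : ∀ x, iteratedDeriv 2 W x = iteratedDeriv 2 W m + iteratedDeriv 3 W m * (x-m)^1
      + k / 2 * (x-m)^2 := by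
    refine aux_eq_of_deriv _ _ (iteratedDeriv 3 W) m (d 2 (by norm_num)) ?_ ?_ (by simp)
    · intro y
      refine ((((hp 0 y).const_mul _).const_add _).add ((hp 1 y).const_mul _)).congr_deriv ?_
      rw [e3 y]; push_cast; ring
    · intro y; rw [← iteratedDeriv_succ]
  have e1 : ∀ x, iteratedDeriv 1 W x = iteratedDeriv 1 W m + iteratedDeriv 2 W m * (x-m)^1
      + iteratedDeriv 3 W m / 2 * (x-m)^2 + k / 6 * (x-m)^3 := by
    refine aux_eq_of_deriv _ _ (iteratedDeriv 2 W) m (d 1 (by norm_num)) ?_ ?_ (by simp)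
    · intro y
      refine (((((hp 0 y).const_mul _).const_add _).add ((hp 1 y).const_mul _)).add
        ((hp 2 y).const_mul _)).congr_deriv ?_
      rw [e2 y]; push_cast; ring
    · intro y; rw [← iteratedDeriv_succ]
  have e0 : ∀ x, W x = W m + iteratedDeriv 1 W m * (x-m)^1 + iteratedDeriv 2 W m / 2 * (x-m)^2
      + iteratedDeriv 3 W m / 6 * (x-m)^3 + k / 24 * (x-m)^4 := by
    refine aux_eq_of_deriv _ _ (iteratedDeriv 1 W) m
      (by simpa using d 0 (by norm_num)) ?_ ?_ (by simp)
    · intro y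
      refine ((((((hp 0 y).const_mul _).const_add _).add ((hp 1 y).const_mul _)).add
        ((hp 2 y).const_mul _)).add ((hp 3 y).const_mul _)).congr_deriv ?_
      rw [e1 y]; push_cast; ring
    · intro y; rw [iteratedDeriv_one]
  rw [e0 x]; ring

lemma aux_pd_smul {N : ℕ} (i : Fin N) (f : Pt N → ℝ) (a t : ℝ) (hf : Differentiable ℝ f) :
    pd i (fun x => a + t * f x) = fun x => t * pd i f x := by
  funext x
  have h : HasFDerivAt (fun x => a + t * f x) (t • fderiv ℝ f x) x :=
    ((hf x).hasFDerivAt.const_mul t).const_add a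
  simp [pd, h.fderiv]

lemma aux_pd_contDiff {N : ℕ} (i : Fin N) (f : Pt N → ℝ) (hf : ContDiff ℝ 2 f) :
    ContDiff ℝ 1 (pd i f) := by
  have : ContDiff ℝ 1 (fderiv ℝ f) := hf.fderiv_right (by norm_num)
  exact this.clm_apply contDiff_const

lemma aux_pd_cont {N : ℕ} (i : Fin N) (f : Pt N → ℝ) (hf : ContDiff ℝ 1 f) :
    Continuous (pd i f) :=
  (hf.continuous_fderiv (by norm_num)).clm_apply continuous_const

lemma aux_gradSq_cont {N : ℕ} (f : Pt N → ℝ) (hf : ContDiff ℝ 1 f) :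
    Continuous (gradSq f) :=
  continuous_finsetSum _ fun i _ => (aux_pd_cont i f hf).pow 2

lemma aux_gradSq_smul {N : ℕ} (f : Pt N → ℝ) (a t : ℝ) (hf : Differentiable ℝ f) (x : Pt N) :
    gradSq (fun x => a + t * f x) x = t^2 * gradSq f x := by
  simp only [gradSq, aux_pd_smul _ f a t hf, Finset.mul_sum, mul_pow]

lemma aux_potential {N : ℕ} (u ψ : Pt N → ℝ) (m t : ℝ) (h : IsPotential u ψ) :
    IsPotential (fun x => (m + t * u x) - m) (fun x => 0 + t * ψ x) := by
  obtain ⟨h1, h2, h3, h4⟩ := h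
  refine ⟨contDiff_const.add (contDiff_const.mul h1), fun x i => by simp only [h2 x i], ?_, ?_⟩
  · simp only [zero_add]; rw [integral_const_mul, h3, mul_zero]
  · intro x
    have hl : lap (fun x => 0 + t * ψ x) x = t * lap ψ x := by
      simp only [lap, pd2, Finset.mul_sum]
      refine Finset.sum_congr rfl fun i _ => ?_
      rw [aux_pd_smul i ψ 0 t (h1.differentiable (by norm_num))]
      have := aux_pd_smul i (pd i ψ) 0 t ((aux_pd_contDiff i ψ h1).differentiable (by norm_num))
      simp only [zero_add] at this
      rw [this]
    rw [hl]; simp only [← h4 x]; ring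

lemma aux_int {N : ℕ} (f : Pt N → ℝ) (hf : Continuous f) :
    Integrable f (volume.restrict (cube N)) :=
  hf.continuousOn.integrableOn_compact isCompact_Icc

lemma aux_vol (N : ℕ) : (volume.restrict (cube N)) =
    Measure.pi (fun _ : Fin N => (volume : Measure ℝ).restrict (Set.Icc 0 1)) := by
  rw [← Measure.restrict_pi_pi, cube, ← Set.pi_univ_Icc]
  rfl

lemma aux_prob : IsProbabilityMeasure ((volume : Measure ℝ).restrict (Set.Icc 0 1)) :=
  ⟨by simp⟩

lemma aux_int_one (N : ℕ) (c : ℝ) : ∫ _ in cube N, c = c := by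
  have := aux_prob
  rw [aux_vol]; simp

lemma aux_int_eval {N : ℕ} (i : Fin N) (g : ℝ → ℝ) (hg : Continuous g) :
    ∫ x in cube N, g (x i) = ∫ s in (0:ℝ)..1, g s := by
  have := aux_prob
  rw [aux_vol, intervalIntegral.integral_of_le zero_le_one, ← integral_Icc_eq_integral_Ioc]
  have h := measurePreserving_eval
    (fun _ : Fin N => (volume : Measure ℝ).restrict (Set.Icc 0 1)) i
  have h2 : ∫ s, g s ∂(Measure.map (Function.eval i) (Measure.pi
      (fun _ : Fin N => (volume : Measure ℝ).restrict (Set.Icc 0 1)))) = _ :=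
    integral_map h.measurable.aemeasurable hg.aestronglyMeasurable
  rw [h.map_eq] at h2
  exact h2.symm

lemma aux_energy {N : ℕ} (m γ k : ℝ) (W : ℝ → ℝ) (hW : ContDiff ℝ 4 W)
    (h4 : ∀ t, iteratedDeriv 4 W t = k) (u ψ : Pt N → ℝ) (hu : AdmissibleQ u)
    (hψ : IsPotential u ψ) (t : ℝ) :
    Een γ W (fun x => m + t * u x) (fun x => 0 + t * ψ x) = W m
      + t^2/2 * (∫ x in cube N, ((1/γ^2) * gradSq u x + gradSq ψ x
          + iteratedDeriv 2 W m * (u x)^2))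
      + t^3 * iteratedDeriv 3 W m / 6 + t^4 * k / 24 * ∫ x in cube N, (u x)^4 := by
  obtain ⟨hu1, hu2, hu3, hu4⟩ := hu
  have hψ1 := hψ.1
  have hg := aux_gradSq_cont u hu1
  have hg' := aux_gradSq_cont ψ (hψ1.of_le (by norm_num))
  have hc := hu1.continuous
  have key : ∀ x, (1/(2*γ^2)) * gradSq (fun x => m + t * u x) x
      + (1/2) * gradSq (fun x => 0 + t * ψ x) x + W (m + t * u x)
      = W m + (t * iteratedDeriv 1 W m) * u x + t^2/2 * ((1/γ^2) * gradSq u x + gradSq ψ x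
          + iteratedDeriv 2 W m * (u x)^2) + (t^3 * iteratedDeriv 3 W m / 6) * (u x)^3
          + (t^4 * k / 24) * (u x)^4 := by
    intro x
    rw [aux_gradSq_smul u m t (hu1.differentiable (by norm_num)),
      aux_gradSq_smul ψ 0 t (hψ1.differentiable (by norm_num)),
      aux_taylor W m k hW h4 (m + t * u x)]
    rw [one_div, one_div, mul_inv]
    ring
  unfold Een
  simp only [key]
  rw [integral_add (aux_int _ (by fun_prop)) (aux_int _ (by fun_prop)),
    integral_add (aux_int _ (by fun_prop)) (aux_int _ (by fun_prop)),
    integral_add (aux_int _ (by fun_prop)) (aux_int _ (by fun_prop)),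
    integral_add (aux_int _ (by fun_prop)) (aux_int _ (by fun_prop)),
    integral_const_mul, integral_const_mul, integral_const_mul, integral_const_mul,
    aux_int_one, hu3, hu4]
  ring

lemma aux_energy_const {N : ℕ} (m γ : ℝ) (W : ℝ → ℝ) :
    Een γ W (fun _ : Pt N => m) (fun _ : Pt N => 0) = W m := by
  simp only [Een, gradSq, pd, fderiv_fun_const]
  have := aux_int_one N (W m)
  simpa using this

lemma aux_B_pos {N : ℕ} (u : Pt N → ℝ) (hu : AdmissibleQ u) : 0 < ∫ x in cube N, (u x)^4 := by
  obtain ⟨hu1, hu2, hu3, hu4⟩ := hu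
  have hc := hu1.continuous
  have h0 : 0 ≤ ∫ x in cube N, (u x)^4 := integral_nonneg fun x => by positivity
  refine lt_of_le_of_ne h0 fun h => ?_
  have := (integral_eq_zero_iff_of_nonneg (fun x => by positivity)
    (aux_int (fun x => (u x)^4) (by fun_prop))).1 h.symm
  have h3 : ∫ x in cube N, (u x)^3 = 0 := by
    refine integral_eq_zero_of_ae ?_
    filter_upwards [this] with x hx
    have : u x = 0 := by simpa using hx
    simp [this]
  rw [h3] at hu3
  exact zero_ne_one hu3

lemma aux_cos_int (n : ℕ) (hn : n ≠ 0) : ∫ s in (0:ℝ)..1, cos (n * (2 * π * s)) = 0 := by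
  have hn' : (n : ℝ) * (2 * π) ≠ 0 := by positivity
  have h : ∀ s : ℝ, (n : ℝ) * (2 * π * s) = (n * (2 * π)) * s := fun s => by ring
  simp only [h]
  rw [intervalIntegral.integral_comp_mul_left (fun s => cos s) hn']
  have : sin ((n : ℝ) * (2 * π)) = 0 := by
    have := Real.sin_nat_mul_pi (2 * n)
    push_cast at this
    rw [← this]; ring_nf
  simp [this]

lemma aux_cube_id (a : ℝ) : (cos a + cos (2 * a))^3 = 3/4 + 9/4 * cos (1 * a) + 9/4 * cos (2 * a)
    + cos (3 * a) + 3/4 * cos (4 * a) + 3/4 * cos (5 * a) + 1/4 * cos (6 * a) := by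
  have h4 : cos (4 * a) = 2 * (cos (2*a))^2 - 1 := by
    rw [← cos_two_mul]; ring_nf
  have h6 : cos (6 * a) = 2 * (cos (3*a))^2 - 1 := by
    rw [← cos_two_mul]; ring_nf
  have h5 : cos (5 * a) = 2 * cos (3 * a) * cos (2 * a) - cos a := by
    have e1 : cos (5 * a) = cos (3 * a + 2 * a) := by ring_nf
    have e2 : cos a = cos (3 * a - 2 * a) := by ring_nf
    rw [cos_sub] at e2
    rw [e1, cos_add]
    linarith
  rw [h5, h4, h6, cos_three_mul, cos_two_mul, one_mul]
  ring

lemma aux_pd_eval {N : ℕ} (i j : Fin N) (g g' : ℝ → ℝ) (hg : ∀ s, HasDerivAt g (g' s) s) :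
    pd j (fun x : Pt N => g (x i)) = fun x => (if j = i then 1 else 0) * g' (x i) := by
  funext x
  have h1 : HasFDerivAt (fun x : Pt N => x i) (ContinuousLinearMap.proj i : Pt N →L[ℝ] ℝ) x :=
    hasFDerivAt_apply i x
  have := (hg (x i)).comp_hasFDerivAt x h1
  have h2 : fderiv ℝ (fun x : Pt N => g (x i)) x = _ := this.fderiv
  rw [pd, h2]
  by_cases h : j = i
  · subst h; simp
  · simp [h, Pi.single_apply, Ne.symm h]

lemma aux_nonempty (N : ℕ) (hN : 0 < N) :
    ∃ u ψ : Pt N → ℝ, AdmissibleQ u ∧ IsPotential u ψ := by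
  obtain ⟨c, hc⟩ : ∃ c : ℝ, c^3 = 4/3 := by
    refine ⟨(4/3 : ℝ)^(1/3 : ℝ), ?_⟩
    rw [← Real.rpow_natCast, ← Real.rpow_mul (by norm_num)]
    norm_num
  let i : Fin N := ⟨0, hN⟩
  have hpi : π ≠ 0 := Real.pi_ne_zero
  have hcos : ∀ n : ℕ, IntervalIntegrable (fun s : ℝ => cos (n * (2 * π * s))) volume 0 1 :=
    fun n => (by fun_prop : Continuous fun s : ℝ => cos (n * (2 * π * s))).intervalIntegrable _ _
  -- general vanishing mean
  have hmean : ∀ a b : ℝ, ∫ s in (0:ℝ)..1, (a * cos (2 * π * s) + b * cos (2 * (2 * π * s))) = 0 := by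
    intro a b
    have h1 := aux_cos_int 1 (by norm_num)
    have h2 := aux_cos_int 2 (by norm_num)
    push_cast at h1 h2
    simp only [one_mul] at h1
    rw [intervalIntegral.integral_add
      (Continuous.intervalIntegrable (by fun_prop) _ _)
      (Continuous.intervalIntegrable (by fun_prop) _ _),
      intervalIntegral.integral_const_mul, intervalIntegral.integral_const_mul, h1, h2]
    simp
  have hper : ∀ a b : ℝ, ZPeriodic (fun x : Pt N =>
      a * cos (2 * π * x i) + b * cos (2 * (2 * π * x i))) := by
    intro a b x j
    by_cases h : j = i
    · subst j
      have e1 : cos (2 * π * (x i + 1)) = cos (2 * π * x i) := by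
        rw [mul_add, mul_one, cos_add_two_pi]
      have e2 : cos (2 * (2 * π * (x i + 1))) = cos (2 * (2 * π * x i)) := by
        rw [cos_two_mul, e1, ← cos_two_mul]
      simp only [Pi.add_apply, Pi.single_eq_same, e1, e2]
    · simp [Pi.single_apply, Ne.symm h]
  refine ⟨fun x => c * cos (2 * π * x i) + c * cos (2 * (2 * π * x i)),
    fun x => (c / (4*π^2)) * cos (2 * π * x i) + (c / (16*π^2)) * cos (2 * (2 * π * x i)),
    ⟨by fun_prop, hper c c, ?_, ?_⟩, ⟨by fun_prop, hper _ _, ?_, ?_⟩⟩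
  · rw [aux_int_eval i (fun s => (c * cos (2 * π * s) + c * cos (2 * (2 * π * s)))^3)
      (by fun_prop)]
    have key : ∀ s : ℝ, (c * cos (2 * π * s) + c * cos (2 * (2 * π * s)))^3 =
        1 + 3 * cos ((1:ℕ) * (2*π*s)) + 3 * cos ((2:ℕ) * (2*π*s)) + 4/3 * cos ((3:ℕ) * (2*π*s))
        + 1 * cos ((4:ℕ) * (2*π*s)) + 1 * cos ((5:ℕ) * (2*π*s))
        + 1/3 * cos ((6:ℕ) * (2*π*s)) := by
      intro s
      rw [← mul_add, mul_pow, aux_cube_id, hc]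
      push_cast
      ring
    simp only [key]
    rw [intervalIntegral.integral_add, intervalIntegral.integral_add,
      intervalIntegral.integral_add, intervalIntegral.integral_add,
      intervalIntegral.integral_add, intervalIntegral.integral_add]
    · simp only [intervalIntegral.integral_const_mul]
      rw [aux_cos_int 1 (by norm_num), aux_cos_int 2 (by norm_num), aux_cos_int 3 (by norm_num),
        aux_cos_int 4 (by norm_num), aux_cos_int 5 (by norm_num), aux_cos_int 6 (by norm_num)]
      simp
    all_goals exact Continuous.intervalIntegrable (by fun_prop) _ _
  · rw [aux_int_eval i (fun s => c * cos (2 * π * s) + c * cos (2 * (2 * π * s))) (by fun_prop)]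
    exact hmean _ _
  · rw [aux_int_eval i (fun s => (c / (4*π^2)) * cos (2 * π * s)
      + (c / (16*π^2)) * cos (2 * (2 * π * s))) (by fun_prop)]
    exact hmean _ _
  · intro x
    have l1 : ∀ s : ℝ, HasDerivAt (fun s : ℝ => 2 * π * s) (2 * π) s := fun s => by
      simpa using (hasDerivAt_id s).const_mul (2 * π)
    have l2 : ∀ s : ℝ, HasDerivAt (fun s : ℝ => 2 * (2 * π * s)) (2 * (2 * π)) s := fun s =>
      (l1 s).const_mul 2
    have d1 : ∀ s : ℝ, HasDerivAt (fun s => (c / (4*π^2)) * cos (2 * π * s)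
        + (c / (16*π^2)) * cos (2 * (2 * π * s)))
        ((c / (4*π^2)) * (-sin (2 * π * s) * (2 * π))
        + (c / (16*π^2)) * (-sin (2 * (2 * π * s)) * (2 * (2 * π)))) s := fun s =>
      ((l1 s).cos.const_mul _).add ((l2 s).cos.const_mul _)
    have d2 : ∀ s : ℝ, HasDerivAt (fun s => (c / (4*π^2)) * (-sin (2 * π * s) * (2 * π))
        + (c / (16*π^2)) * (-sin (2 * (2 * π * s)) * (2 * (2 * π))))
        ((c / (4*π^2)) * (-(cos (2 * π * s) * (2 * π)) * (2 * π))
        + (c / (16*π^2)) * (-(cos (2 * (2 * π * s)) * (2 * (2 * π))) * (2 * (2 * π)))) s := fun s =>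
      (((l1 s).sin.neg.mul_const _).const_mul _).add (((l2 s).sin.neg.mul_const _).const_mul _)
    unfold lap
    rw [Finset.sum_eq_single i]
    · have p1 := aux_pd_eval i i _ _ d1
      have p2 := aux_pd_eval i i _ _ d2
      simp only [if_true, one_mul] at p1 p2
      rw [pd2, p1, p2]
      field_simp
      ring
    · intro j _ hj
      have p1 := aux_pd_eval i j _ _ d1
      simp only [hj, if_false, zero_mul] at p1
      rw [pd2, p1]
      simp [pd]
    · simp

lemma aux_choose_t (A B V w : ℝ) (hB : 0 < B) (hw : 0 < w) (h : A * B < V^2 / (3 * w^2)) :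
    ∃ t : ℝ, t^2/2 * A + t^3 * V / 6 + t^4 * w^2 / 24 * B < 0 := by
  by_cases hV : V = 0
  · subst hV
    have hA : A < 0 := by
      by_contra hA
      push Not at hA
      have := mul_nonneg hA hB.le
      simp at h
      linarith
    have hs : 0 < -6 * A / (w^2 * B) := div_pos (by linarith) (by positivity)
    refine ⟨sqrt (-6 * A / (w^2 * B)), ?_⟩
    have e := Real.sq_sqrt hs.le
    set t := sqrt (-6 * A / (w^2 * B))
    have e2 : t^2 * (w^2 * B) = -6 * A := by rw [e]; field_simp
    have : t^2/2 * A + t^3 * 0 / 6 + t^4 * w^2 / 24 * B = t^2 * A / 4 := by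
      linear_combination t^2/24 * e2
    rw [this, e]
    have := mul_neg_of_pos_of_neg hs hA
    linarith
  · refine ⟨-2 * V / (w^2 * B), ?_⟩
    have hpos : 0 < (V / (w^2 * B))^2 * (2 / B) := by positivity
    have : (-2 * V / (w^2 * B))^2/2 * A + (-2 * V / (w^2 * B))^3 * V / 6
        + (-2 * V / (w^2 * B))^4 * w^2 / 24 * B
        = (V / (w^2 * B))^2 * (2 / B) * (A * B - V^2 / (3 * w^2)) := by
      field_simp
      ring
    rw [this]
    exact mul_neg_of_pos_of_neg hpos (by linarith)

end Helpers

/-- Theorem 1.5, part 3: failure of global minimality when Q_N is below the threshold. -/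
theorem OK_uniform_state_not_global_min (N : ℕ) (hN : 0 < N) (hN6 : N < 6)
    (m γ w : ℝ) (hγ : 0 < γ) (W : ℝ → ℝ) (hw : 0 < w) (hW : ContDiff ℝ 4 W)
    (hW4 : ∀ t : ℝ, iteratedDeriv 4 W t = w^2)
    (hstab : 0 < iteratedDeriv 2 W m + freqMinOK N γ)
    (hQ : QN N γ (iteratedDeriv 2 W m) < (iteratedDeriv 3 W m)^2 / (3 * w^2)) :
    ∃ φ ψ : Pt N → ℝ, MemH1m m φ ∧ IsPotential (fun x => φ x - m) ψ ∧
      Een γ W φ ψ < Een γ W (fun _ : Pt N => m) (fun _ : Pt N => 0) := by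
  have hex : ∃ u ψ : Pt N → ℝ, AdmissibleQ u ∧ IsPotential u ψ ∧
      Qenergy γ (iteratedDeriv 2 W m) u ψ < (iteratedDeriv 3 W m)^2 / (3 * w^2) := by
    by_contra hcon
    push Not at hcon
    refine absurd hQ (not_lt.2 ?_)
    refine le_csInf ?_ ?_
    · obtain ⟨u, ψ, h1, h2⟩ := aux_nonempty N hN
      exact ⟨_, u, ψ, h1, h2, rfl⟩
    · rintro q ⟨u, ψ, h1, h2, rfl⟩
      exact hcon u ψ h1 h2
  obtain ⟨u, ψ, hu, hψ, hlt⟩ := hex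
  have hB := aux_B_pos u hu
  obtain ⟨t, ht⟩ := aux_choose_t _ _ _ w hB hw hlt
  refine ⟨fun x => m + t * u x, fun x => 0 + t * ψ x, ⟨?_, ?_, ?_⟩, aux_potential u ψ m t hψ, ?_⟩
  · exact contDiff_const.add (contDiff_const.mul hu.1)
  · intro x i
    simp only [hu.2.1 x i]
  · have hc := hu.1.continuous
    rw [integral_add (aux_int _ (by fun_prop)) (aux_int _ (by fun_prop)), aux_int_one,
      integral_const_mul, hu.2.2.2]
    simp
  · rw [aux_energy_const, aux_energy m γ (w^2) W hW hW4 u ψ hu hψ t]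
    linarith

end
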